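/- For every d ≥ 1, there exists an invertible d×d matrix M over 𝔽₂ satisfying M² = I (so M = M⁻¹) such that M·B_d·M equals the companion matrix C_{(x+1)^d} of the polynomial (x+1)^d over 𝔽₂. -/

import Mathlib

open Polynomial Matrix

/-- The `d × d` matrix over `𝔽₂` with ones on the main diagonal and on the first
subdiagonal, and zeros elsewhere. -/
def Bmat (d : ℕ) : Matrix (Fin d) (Fin d) (ZMod 2) :=
  Matrix.of fun i j =>
    if (i : ℕ) = (j : ℕ) then 1
    else if (i : ℕ) = (j : ℕ) + 1 then 1 else 0

/-- The companion matrix of a monic polynomial `f` of degree `d` over `𝔽₂`: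
ones in positions `(i+1, i)` for `0 ≤ i < d-1`, last column has entry `coeff j` in row `j`
(note `-a = a` over `𝔽₂`), and zeros elsewhere. -/
def companionMatrix (d : ℕ) (f : Polynomial (ZMod 2)) :
    Matrix (Fin d) (Fin d) (ZMod 2) :=
  Matrix.of fun i j =>
    if (i : ℕ) = (j : ℕ) + 1 then 1
    else if (j : ℕ) = d - 1 then f.coeff (i : ℕ) else 0

/-- The upper triangular Pascal matrix over `𝔽₂`: column `j` holds the coefficients of
`(X + 1) ^ j`. -/
def pascalMatrix (d : ℕ) : Matrix (Fin d) (Fin d) (ZMod 2) :=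
  Matrix.of fun i j => ((j : ℕ).choose i : ZMod 2)

theorem pascalMatrix_mul_self (d : ℕ) : pascalMatrix d * pascalMatrix d = 1 := by
  ext i j
  have hX : (X : (ZMod 2)[X]) = (X + 1) + 1 := by
    rw [add_assoc, CharTwo.add_self_eq_zero, add_zero]
  have hcoeff := congrArg (fun p : (ZMod 2)[X] => p.coeff (i : ℕ))
    (congrArg (· ^ (j : ℕ)) hX)
  simp only [add_pow (X + 1 : (ZMod 2)[X]), one_pow, mul_one, finsetSum_coeff, coeff_X_pow,
    coeff_mul_natCast, coeff_X_add_one_pow] at hcoeff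
  simp only [Matrix.mul_apply, pascalMatrix, Matrix.of_apply, Matrix.one_apply, Fin.ext_iff]
  rw [hcoeff, Fin.sum_univ_eq_sum_range
    (fun k => (k.choose i : ZMod 2) * ((j : ℕ).choose k : ZMod 2)) d]
  refine (Finset.sum_subset (Finset.range_mono j.isLt) fun k _ hk => ?_).symm
  rw [Nat.choose_eq_zero_of_lt (show (j : ℕ) < k by simpa using hk),
    Nat.cast_zero, mul_zero]

theorem pascalMatrix_mul_Bmat (d : ℕ) :
    pascalMatrix d * Bmat d = companionMatrix d ((X + 1) ^ d) * pascalMatrix d := by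
  ext i j
  have hi := i.isLt
  have hj := j.isLt
  have hB (k : ℕ) : (k.choose i : ZMod 2) *
      (if k = (j : ℕ) then 1 else if k = (j : ℕ) + 1 then 1 else 0) =
      (if k = (j : ℕ) then (k.choose i : ZMod 2) else 0) +
      (if k = (j : ℕ) + 1 then (k.choose i : ZMod 2) else 0) := by
    split_ifs <;> first | omega | simp
  have hC (k : ℕ) : (if (i : ℕ) = k + 1 then (1 : ZMod 2) else
      if k = d - 1 then (d.choose i : ZMod 2) else 0) * ((j : ℕ).choose k : ZMod 2) =
      (if k + 1 = (i : ℕ) then ((j : ℕ).choose k : ZMod 2) else 0) +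
      (if k = d - 1 then (d.choose i : ZMod 2) * ((j : ℕ).choose k : ZMod 2) else 0) := by
    split_ifs <;> first | omega | simp
  simp only [Matrix.mul_apply, pascalMatrix, Bmat, companionMatrix, Matrix.of_apply,
    coeff_X_add_one_pow]
  rw [Fin.sum_univ_eq_sum_range (fun k => (k.choose i : ZMod 2) *
      (if k = (j : ℕ) then 1 else if k = (j : ℕ) + 1 then 1 else 0)) d,
    Fin.sum_univ_eq_sum_range (fun k => (if (i : ℕ) = k + 1 then (1 : ZMod 2) else
      if k = d - 1 then (d.choose i : ZMod 2) else 0) * ((j : ℕ).choose k : ZMod 2)) d]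
  simp only [hB, hC, Finset.sum_add_distrib, Finset.sum_ite_eq', Finset.mem_range, hj, if_true,
    show d - 1 < d by omega]
  have hshift : ∑ k ∈ Finset.range d, (if k + 1 = (i : ℕ) then ((j : ℕ).choose k : ZMod 2) else 0)
      = ((j : ℕ).choose i : ZMod 2) + (((j : ℕ) + 1).choose i : ZMod 2) := by
    obtain h | ⟨m, hm⟩ : (i : ℕ) = 0 ∨ ∃ m, (i : ℕ) = m + 1 := by
      cases (i : ℕ) <;> simp
    · simp [h, CharTwo.add_self_eq_zero]
    · simp only [hm, add_left_inj, Finset.sum_ite_eq', Finset.mem_range, show m < d by omega,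
        if_true, Nat.choose_succ_succ' (j : ℕ) m, Nat.cast_add]
      rw [add_left_comm, CharTwo.add_self_eq_zero, add_zero]
  rw [hshift]
  by_cases h : (j : ℕ) + 1 < d
  · rw [if_pos h, Nat.choose_eq_zero_of_lt (show (j : ℕ) < d - 1 by omega)]
    simp
  · have hd : d = (j : ℕ) + 1 := by omega
    rw [if_neg h, show d - 1 = (j : ℕ) by omega, Nat.choose_self, Nat.cast_one, mul_one,
      add_assoc, show d.choose i = ((j : ℕ) + 1).choose i by rw [← hd],
      CharTwo.add_self_eq_zero]

/-- For every `d ≥ 1` there is an invertible involution `M` over `𝔽₂` conjugating `B_d`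
to the companion matrix of `(x + 1)^d`. -/
theorem Bmat_conj_companion (d : ℕ) (hd : 1 ≤ d) :
    ∃ M : Matrix (Fin d) (Fin d) (ZMod 2), IsUnit M ∧ M * M = 1 ∧
      M * Bmat d * M = companionMatrix d ((X + 1) ^ d) := by
  refine ⟨pascalMatrix d, IsUnit.of_mul_eq_one _ (pascalMatrix_mul_self d),
    pascalMatrix_mul_self d, ?_⟩
  rw [pascalMatrix_mul_Bmat, Matrix.mul_assoc, pascalMatrix_mul_self, Matrix.mul_one]
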